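/- arXiv:2203.03095 — 4 statements merged into one kernel-verified Lean document; each statement's English description precedes it below -/
import Mathlib

section
/- Let U ⊆ ℝ^m be open and connected, let A₁, …, A_m : U → ℝ^{s×s} be continuous matrix-valued functions, and let V be the set of continuously differentiable solutions q : U → ℝ^s of the Pfaffian system ∂_i q = A_i q (i = 1, …, m) on U. Then V is a real vector space under pointwise addition and scalar multiplication, and for any fixed z̄ ∈ U the evaluation map ψ_{z̄} : V → ℝ^s, q ↦ q(z̄), is an injective linear map; consequently, the dimension of V over ℝ is at most s. -/
open Matrix

/-- A function on an open preconnected set whose derivative is bounded by a continuous multiple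
of the function itself vanishes identically as soon as it vanishes at one point. -/
theorem eqOn_zero_of_norm_fderiv_le {E F : Type*} [NormedAddCommGroup E] [NormedSpace ℝ E]
    [NormedAddCommGroup F] [NormedSpace ℝ F] {U : Set E} (hU : IsOpen U)
    (hUconn : IsPreconnected U) {q : E → F} (hq : DifferentiableOn ℝ q U) {g : E → ℝ}
    (hg : ContinuousOn g U) (hbound : ∀ z ∈ U, ‖fderiv ℝ q z‖ ≤ g z * ‖q z‖)
    {x₀ : E} (hx₀ : x₀ ∈ U) (hqx₀ : q x₀ = 0) : Set.EqOn q 0 U := by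
  have key : ∀ x ∈ U, ∃ r > 0, ∀ y ∈ Metric.ball x r, q y = 0 →
      ∀ w ∈ Metric.ball x r, q w = 0 := by
    intro x hx
    have hev : ∀ᶠ z in nhds x, z ∈ U ∧ g z < g x + 1 :=
      Filter.Eventually.and (hU.mem_nhds hx)
        ((hg.continuousAt (hU.mem_nhds hx)).eventually_lt_const (lt_add_one (g x)))
    obtain ⟨r, hr, hball⟩ := Metric.eventually_nhds_iff_ball.1 hev
    refine ⟨r, hr, fun y hy hqy w hw => ?_⟩
    have hmem : ∀ t ∈ Set.Icc (0 : ℝ) 1, AffineMap.lineMap y w t ∈ Metric.ball x r :=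
      fun t ht => (convex_ball x r).lineMap_mem hy hw ht
    have hderiv : ∀ t ∈ Set.Icc (0 : ℝ) 1,
        HasDerivAt (fun t : ℝ => q (AffineMap.lineMap y w t))
          (fderiv ℝ q (AffineMap.lineMap y w t) (w - y)) t := fun t ht =>
      ((hq.differentiableAt (hU.mem_nhds (hball _ (hmem t ht)).1)).hasFDerivAt).comp_hasDerivAt t
        AffineMap.hasDerivAt_lineMap
    have hzero := eq_zero_of_abs_deriv_le_mul_abs_self_of_eq_zero_right
      (f := fun t : ℝ => q (AffineMap.lineMap y w t)) (K := (g x + 1) * ‖w - y‖)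
      (fun t ht => (hderiv t ht).continuousAt.continuousWithinAt)
      (fun t ht => (hderiv t (Set.Ico_subset_Icc_self ht)).hasDerivWithinAt)
      (by simpa using hqy)
      (fun t ht => by
        obtain ⟨hzU, hgz⟩ := hball _ (hmem t (Set.Ico_subset_Icc_self ht))
        calc _ ≤ ‖fderiv ℝ q (AffineMap.lineMap y w t)‖ * ‖w - y‖ :=
              ContinuousLinearMap.le_opNorm _ _
          _ ≤ ((g x + 1) * ‖q (AffineMap.lineMap y w t)‖) * ‖w - y‖ := by
              gcongr
              exact (hbound _ hzU).trans (by gcongr)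
          _ = _ := by ring)
    simpa using hzero 1 (by simp)
  have hsub : U ⊆ interior {z | q z = 0} := by
    refine hUconn.subset_of_closure_inter_subset isOpen_interior ⟨x₀, hx₀, ?_⟩ ?_
    · obtain ⟨r, hr, h⟩ := key x₀ hx₀
      exact mem_interior_iff_mem_nhds.2 (Filter.mem_of_superset (Metric.ball_mem_nhds x₀ hr)
        (h x₀ (Metric.mem_ball_self hr) hqx₀))
    · rintro x ⟨hxcl, hx⟩
      obtain ⟨r, hr, h⟩ := key x hx
      obtain ⟨y, hyball, hy⟩ := mem_closure_iff_nhds.1 hxcl _ (Metric.ball_mem_nhds x hr)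
      exact mem_interior_iff_mem_nhds.2 (Filter.mem_of_superset (Metric.ball_mem_nhds x hr)
        (h y hyball (interior_subset (s := {z | q z = 0}) hy)))
  exact fun z hz => interior_subset (s := {z | q z = 0}) (hsub hz)

/-- The continuously differentiable solutions of the Pfaffian system `∂_i q = A_i q` on an open
set `U`, as a real vector space. -/
def pfaffianSolutions {m s : ℕ} {U : Set (Fin m → ℝ)} (hU : IsOpen U)
    (A : Fin m → (Fin m → ℝ) → Matrix (Fin s) (Fin s) ℝ) :
    Submodule ℝ ((Fin m → ℝ) → (Fin s → ℝ)) where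
  carrier := {q | ContDiffOn ℝ 1 q U ∧
    ∀ z ∈ U, ∀ i, fderiv ℝ q z (Pi.single i 1) = A i z *ᵥ q z}
  zero_mem' := ⟨contDiffOn_const (c := (0 : Fin s → ℝ)), fun z _ i => by simp⟩
  add_mem' := by
    rintro p q ⟨hp, hp'⟩ ⟨hq, hq'⟩
    refine ⟨hp.add hq, fun z hz i => ?_⟩
    have hpz := (hp.differentiableOn one_ne_zero).differentiableAt (hU.mem_nhds hz)
    have hqz := (hq.differentiableOn one_ne_zero).differentiableAt (hU.mem_nhds hz)
    rw [fderiv_add hpz hqz]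
    simp [hp' z hz i, hq' z hz i, mulVec_add]
  smul_mem' := by
    rintro c q ⟨hq, hq'⟩
    refine ⟨contDiffOn_const.smul hq, fun z hz i => ?_⟩
    have hqz := (hq.differentiableOn one_ne_zero).differentiableAt (hU.mem_nhds hz)
    rw [fderiv_const_smul hqz]
    simp [hq' z hz i, mulVec_smul]

theorem norm_mulVec_le_sum_abs {s : ℕ} (B : Matrix (Fin s) (Fin s) ℝ) (v : Fin s → ℝ) :
    ‖B *ᵥ v‖ ≤ (∑ k, ∑ l, |B k l|) * ‖v‖ := by
  refine (pi_norm_le_iff_of_nonneg (by positivity)).2 fun k => ?_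
  calc ‖(B *ᵥ v) k‖ ≤ ∑ l, ‖B k l * v l‖ := norm_sum_le Finset.univ fun l => B k l * v l
    _ ≤ ∑ l, |B k l| * ‖v‖ := by
        gcongr with l
        rw [norm_mul, Real.norm_eq_abs (B k l)]
        gcongr
        exact norm_le_pi_norm v l
    _ = (∑ l, |B k l|) * ‖v‖ := by rw [Finset.sum_mul]
    _ ≤ _ := by
        refine mul_le_mul_of_nonneg_right ?_ (norm_nonneg v)
        exact Finset.single_le_sum (f := fun k => ∑ l, |B k l|)
          (fun _ _ => by positivity) (Finset.mem_univ k)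

theorem pfaffianSolutions_eqOn_zero {m s : ℕ} {U : Set (Fin m → ℝ)} (hU : IsOpen U)
    (hUconn : IsPreconnected U) {A : Fin m → (Fin m → ℝ) → Matrix (Fin s) (Fin s) ℝ}
    (hA : ∀ i k l, ContinuousOn (fun z => A i z k l) U)
    {q : (Fin m → ℝ) → (Fin s → ℝ)} (hq : q ∈ pfaffianSolutions hU A)
    {x₀ : Fin m → ℝ} (hx₀ : x₀ ∈ U) (hqx₀ : q x₀ = 0) : Set.EqOn q 0 U := by
  refine eqOn_zero_of_norm_fderiv_le hU hUconn (hq.1.differentiableOn one_ne_zero)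
    (g := fun z => ∑ i, ∑ k, ∑ l, |A i z k l|) ?_ (fun z hz => ?_) hx₀ hqx₀
  · exact continuousOn_finsetSum _ fun i _ => continuousOn_finsetSum _ fun k _ =>
      continuousOn_finsetSum _ fun l _ => (hA i k l).abs
  · refine ContinuousLinearMap.opNorm_le_bound _ (by positivity) fun v => ?_
    have hv : fderiv ℝ q z v = ∑ i, v i • (A i z *ᵥ q z) := by
      conv_lhs => rw [pi_eq_sum_univ' v]
      simp only [map_sum, map_smul]
      exact Finset.sum_congr rfl fun i _ => by rw [← hq.2 z hz i]
    rw [hv, Finset.sum_mul, Finset.sum_mul]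
    refine norm_sum_le_of_le _ fun i _ => ?_
    rw [norm_smul, mul_comm]
    exact mul_le_mul (norm_mulVec_le_sum_abs _ _) (norm_le_pi_norm v i) (norm_nonneg _)
      (by positivity)

/-- The set `V` of continuously differentiable solutions of a Pfaffian system
`∂_i q = A_i q` on an open connected set `U` is a real vector space under pointwise
operations, evaluation at a fixed `zbar ∈ U` is injective and linear on `V`
(injectivity meaning solutions agreeing at `zbar` agree on all of `U`), and
consequently the dimension of `V` is at most `s`: any `s + 1` solutions are
linearly dependent over `ℝ` (as functions on `U`). -/
theorem stmt9 {m s : ℕ}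
    (U : Set (Fin m → ℝ)) (hU : IsOpen U) (hUconn : IsConnected U)
    (A : Fin m → (Fin m → ℝ) → Matrix (Fin s) (Fin s) ℝ)
    (hA : ∀ i k l, ContinuousOn (fun z => A i z k l) U)
    (V : Set ((Fin m → ℝ) → (Fin s → ℝ)))
    (hV : V = {q | ContDiffOn ℝ 1 q U ∧
      ∀ z ∈ U, ∀ i, fderiv ℝ q z (Pi.single i 1) = A i z *ᵥ q z})
    (zbar : Fin m → ℝ) (hzbar : zbar ∈ U) :
    (∀ q₁ ∈ V, ∀ q₂ ∈ V, q₁ + q₂ ∈ V) ∧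
    (∀ c : ℝ, ∀ q ∈ V, c • q ∈ V) ∧
    ((0 : (Fin m → ℝ) → (Fin s → ℝ)) ∈ V) ∧
    (∀ q₁ ∈ V, ∀ q₂ ∈ V, (q₁ + q₂) zbar = q₁ zbar + q₂ zbar) ∧
    (∀ c : ℝ, ∀ q ∈ V, (c • q) zbar = c • q zbar) ∧
    (∀ q₁ ∈ V, ∀ q₂ ∈ V, q₁ zbar = q₂ zbar → Set.EqOn q₁ q₂ U) ∧
    (∀ q : Fin (s + 1) → ((Fin m → ℝ) → (Fin s → ℝ)), (∀ j, q j ∈ V) →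
      ∃ c : Fin (s + 1) → ℝ, c ≠ 0 ∧ ∀ z ∈ U, ∑ j, c j • q j z = 0) := by
  obtain rfl : V = pfaffianSolutions hU A := hV
  simp only [SetLike.mem_coe]
  refine ⟨fun _ h₁ _ h₂ => add_mem h₁ h₂, fun c _ h => Submodule.smul_mem _ c h, zero_mem _,
    fun _ _ _ _ => rfl, fun _ _ _ => rfl, fun q₁ h₁ q₂ h₂ h z hz => ?_, fun q hq => ?_⟩
  · exact sub_eq_zero.1 (pfaffianSolutions_eqOn_zero hU hUconn.isPreconnected hA
      (sub_mem h₁ h₂) hzbar (sub_eq_zero.2 h) hz)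
  · have hdep : ¬ LinearIndependent ℝ fun j => q j zbar := fun h => by
      simpa using h.fintype_card_le_finrank
    obtain ⟨c, hc, j, hj⟩ := Fintype.not_linearIndependent_iff.1 hdep
    refine ⟨c, fun h => hj (congrFun h j), fun z hz => ?_⟩
    have hmem : ∑ j, c j • q j ∈ pfaffianSolutions hU A :=
      sum_mem fun j _ => Submodule.smul_mem _ (c j) (hq j)
    simpa [Finset.sum_apply] using pfaffianSolutions_eqOn_zero hU hUconn.isPreconnected hA
      hmem hzbar (by simpa [Finset.sum_apply] using hc) hz
end

section
/- Let U ⊆ ℝⁿ × ℝⁿ be open and connected, let A₁, …, A_{2n} : U → ℝ^{d×d} be real-analytic matrix-valued functions, let B_x : U → ℝ^{n×d} be the matrix whose k-th row is the first row of A_k (k = 1, …, n), let B_p : U → ℝ^{n×d} be the matrix whose k-th row is the first row of A_{n+k} (k = 1, …, n), and set Ω := B_pᵀ B_x − B_xᵀ B_p. Let q₁, …, q_n : U → ℝ^d be real-analytic solutions of the Pfaffian system ∂_i q = A_i q (i = 1, …, 2n), and let f₁, …, f_n : U → ℝ be differentiable functions with ∇_x f_k = B_x q_k and ∇_p f_k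 = B_p q_k on U for each k. Fix z̄ ∈ U and suppose q_k(z̄)ᵀ (𝒟^α Ω)(z̄) q_l(z̄) = 0 for every multi-index α ∈ ℤ_{≥0}^{2n} and all 1 ≤ k < l ≤ n. Then {f_k, f_l}(z) = 0 for all z ∈ U and all 1 ≤ k < l ≤ n; moreover, the matrix [∇_p f₁(z̄) ⋯ ∇_p f_n(z̄)] equals B_p(z̄)[q₁(z̄) ⋯ q_n(z̄)], so the former is nonsingular if and only if the latter is. -/
open Matrix

/-- Partial derivative `∂_i` of a scalar function on `ℝ^m`. -/
noncomputable def pd {m : ℕ} (i : Fin m) (f : (Fin m → ℝ) → ℝ) : (Fin m → ℝ) → ℝ :=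
  fun z => fderiv ℝ f z (Pi.single i 1)

/-- Iterated partial derivative `∂^α = ∂₁^{α₁} ⋯ ∂_m^{α_m}` for a multi-index `α`. -/
noncomputable def pdMulti {m : ℕ} (α : Fin m → ℕ) (f : (Fin m → ℝ) → ℝ) :
    (Fin m → ℝ) → ℝ :=
  ((List.finRange m).foldr (fun i F => (pd i)^[α i] ∘ F) id) f

/-- Entrywise partial derivative `∂_i` of a matrix-valued function on `ℝ^m`. -/
noncomputable def pdM {m d : ℕ} (i : Fin m) (M : (Fin m → ℝ) → Matrix (Fin d) (Fin d) ℝ) :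
    (Fin m → ℝ) → Matrix (Fin d) (Fin d) ℝ :=
  fun z => Matrix.of fun k l => fderiv ℝ (fun y => M y k l) z (Pi.single i 1)

/-- The mapping `D_i Ω := A_iᵀ Ω + Ω A_i + ∂_i Ω`. -/
noncomputable def Dop {m d : ℕ} (A : Fin m → (Fin m → ℝ) → Matrix (Fin d) (Fin d) ℝ)
    (i : Fin m) (Ω : (Fin m → ℝ) → Matrix (Fin d) (Fin d) ℝ) :
    (Fin m → ℝ) → Matrix (Fin d) (Fin d) ℝ :=
  fun z => (A i z)ᵀ * Ω z + Ω z * A i z + pdM i Ω z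

/-- `𝒟^α Ω = D₁^{α₁} ∘ D₂^{α₂} ∘ ⋯ ∘ D_m^{α_m}` applied to `Ω`, for a multi-index `α`. -/
noncomputable def DopMulti {m d : ℕ} (A : Fin m → (Fin m → ℝ) → Matrix (Fin d) (Fin d) ℝ)
    (α : Fin m → ℕ) (Ω : (Fin m → ℝ) → Matrix (Fin d) (Fin d) ℝ) :
    (Fin m → ℝ) → Matrix (Fin d) (Fin d) ℝ :=
  ((List.finRange m).foldr (fun i F => (Dop A i)^[α i] ∘ F) id) Ω

section PartialDerivatives

variable {m : ℕ}

theorem pd_analyticOnNhd {U : Set (Fin m → ℝ)} {g : (Fin m → ℝ) → ℝ} (i : Fin m)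
    (hg : AnalyticOnNhd ℝ g U) : AnalyticOnNhd ℝ (pd i g) U := fun z hz =>
  ((ContinuousLinearMap.apply ℝ ℝ (Pi.single i 1 : Fin m → ℝ)).analyticAt _).comp
    (hg.fderiv z hz)

theorem pd_iterate_analyticOnNhd {U : Set (Fin m → ℝ)} {g : (Fin m → ℝ) → ℝ} (i : Fin m) (j : ℕ)
    (hg : AnalyticOnNhd ℝ g U) : AnalyticOnNhd ℝ ((pd i)^[j] g) U := by
  induction j with
  | zero => exact hg
  | succ j ih => rw [Function.iterate_succ_apply']; exact pd_analyticOnNhd i ih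

theorem pd_foldr_analyticOnNhd {U : Set (Fin m → ℝ)} {g : (Fin m → ℝ) → ℝ} (α : Fin m → ℕ)
    (L : List (Fin m)) (hg : AnalyticOnNhd ℝ g U) :
    AnalyticOnNhd ℝ (L.foldr (fun i F => (pd i)^[α i] ∘ F) id g) U := by
  induction L with
  | nil => exact hg
  | cons i L ih => exact pd_iterate_analyticOnNhd i _ ih

theorem foldr_iterate_update_of_notMem {X : Type*} (T : Fin m → X → X) (α : Fin m → ℕ) (i : Fin m)
    (j : ℕ) (L : List (Fin m)) (hi : i ∉ L) :
    L.foldr (fun k F => (T k)^[Function.update α i j k] ∘ F) id =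
      L.foldr (fun k F => (T k)^[α k] ∘ F) id := by
  induction L with
  | nil => rfl
  | cons k L ih =>
    simp only [List.mem_cons, not_or] at hi
    simp only [List.foldr_cons, ih hi.2, Function.update_of_ne (Ne.symm hi.1)]

theorem pd_congr {U : Set (Fin m → ℝ)} (hU : IsOpen U) (i : Fin m) {g h : (Fin m → ℝ) → ℝ}
    (hgh : Set.EqOn g h U) : Set.EqOn (pd i g) (pd i h) U := fun z hz => by
  unfold pd
  rw [(hgh.eventuallyEq_of_mem (hU.mem_nhds hz)).fderiv_eq]

/-- Derivatives along a coordinate line are iterated partial derivatives. -/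
theorem iteratedDeriv_comp_update {V : Set (Fin m → ℝ)} (hV : IsOpen V) (w : Fin m → ℝ)
    (i : Fin m) (j : ℕ) {h : (Fin m → ℝ) → ℝ} (hh : AnalyticOnNhd ℝ h V) {t : ℝ}
    (ht : Function.update w i t ∈ V) :
    iteratedDeriv j (fun s => h (Function.update w i s)) t =
      (pd i)^[j] h (Function.update w i t) := by
  induction j generalizing h with
  | zero => simp
  | succ j ih =>
    rw [iteratedDeriv_succ', Function.iterate_succ_apply, ← ih (pd_analyticOnNhd i hh)]
    apply Filter.EventuallyEq.iteratedDeriv_eq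
    have hcont : Continuous fun s : ℝ => Function.update w i s :=
      continuous_const.update i continuous_id
    filter_upwards [hcont.continuousAt.preimage_mem_nhds (hV.mem_nhds ht)] with s hs
    exact ((hh _ hs).differentiableAt.hasFDerivAt.comp_hasDerivAt s
      (hasDerivAt_update w i s)).deriv

theorem analyticAt_update (w : Fin m → ℝ) (i : Fin m) (t : ℝ) :
    AnalyticAt ℝ (fun s : ℝ => Function.update w i s) t := by
  rw [analyticAt_pi_iff]
  intro k
  by_cases hk : k = i
  · subst hk
    simp only [Function.update_self]
    exact analyticAt_id
  · simpa [Function.update_of_ne hk] using analyticAt_const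

/-- An analytic function on the line all of whose derivatives vanish at a point vanishes. -/
theorem eqOn_zero_of_iteratedDeriv_eq_zero {φ : ℝ → ℝ} {I : Set ℝ} (hφ : AnalyticOnNhd ℝ φ I)
    (hI : IsPreconnected I) {t : ℝ} (ht : t ∈ I) (h : ∀ j, iteratedDeriv j φ t = 0) :
    Set.EqOn φ 0 I := by
  refine hφ.eqOn_zero_of_preconnected_of_eventuallyEq_zero hI ht ?_
  have : analyticOrderAt φ t = ⊤ := by
    rw [ENat.eq_top_iff_forall_ge]
    intro N
    exact (natCast_le_analyticOrderAt_iff_iteratedDeriv_eq_zero (hφ t ht)).mpr fun j _ => h j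
  exact analyticOrderAt_eq_top.mp this

/-- If, after resetting the coordinates in `L` to those of the centre, all ordered partial
derivatives in the directions `L` vanish, then the function vanishes. -/
theorem eq_zero_of_pd_foldr_eq_zero {c : Fin m → ℝ} {ε : ℝ} (hε : 0 < ε) {g : (Fin m → ℝ) → ℝ}
    (hg : AnalyticOnNhd ℝ g (Metric.ball c ε)) (L : List (Fin m)) (hL : L.Nodup)
    (z : Fin m → ℝ) (hz : z ∈ Metric.ball c ε)
    (h : ∀ α : Fin m → ℕ, L.foldr (fun i F => (pd i)^[α i] ∘ F) id g
      (fun k => if k ∈ L then c k else z k) = 0) : g z = 0 := by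
  induction L with
  | nil => simpa using h 0
  | cons i L ih =>
    obtain ⟨hi, hL'⟩ := List.nodup_cons.mp hL
    refine ih hL' fun α => ?_
    set w : Fin m → ℝ := fun k => if k ∈ L then c k else z k with hw
    have hball : ∀ t ∈ Metric.ball (c i) ε, Function.update w i t ∈ Metric.ball c ε := by
      intro t ht
      rw [ball_pi _ hε, Set.mem_univ_pi] at hz ⊢
      intro k
      by_cases hk : k = i
      · subst hk; simpa using ht
      · rw [Function.update_of_ne hk]
        simp only [hw]
        split_ifs
        · exact Metric.mem_ball_self hε
        · exact hz k
    have hP := pd_foldr_analyticOnNhd α L hg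
    have hzero := eqOn_zero_of_iteratedDeriv_eq_zero
      (φ := fun s => L.foldr (fun i F => (pd i)^[α i] ∘ F) id g (Function.update w i s))
      (fun t ht => (hP _ (hball t ht)).comp (analyticAt_update w i t))
      (convex_ball (c i) ε).isPreconnected (Metric.mem_ball_self hε) (fun j => by
        rw [iteratedDeriv_comp_update Metric.isOpen_ball w i j hP
          (hball _ (Metric.mem_ball_self hε))]
        have hj := h (Function.update α i j)
        rw [List.foldr_cons, foldr_iterate_update_of_notMem pd α i j L hi,
          Function.update_self] at hj
        have hpt : Function.update w i (c i) = fun k => if k ∈ i :: L then c k else z k := by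
          funext k
          by_cases hk : k = i
          · subst hk; simp
          · simp [hk, hw]
        rw [hpt]
        exact hj)
    have hzi : z i ∈ Metric.ball (c i) ε := by
      rw [ball_pi _ hε, Set.mem_univ_pi] at hz
      exact hz i
    have hwz : Function.update w i (z i) = w := by
      have : w i = z i := by simp [hw, hi]
      rw [← this, Function.update_eq_self]
    simpa [hwz] using hzero hzi

/-- Identity theorem: an analytic function on a connected open set vanishes if all its ordered
partial derivatives vanish at one point. -/
theorem eqOn_zero_of_pdMulti_eq_zero {U : Set (Fin m → ℝ)} (hU : IsOpen U)
    (hUconn : IsPreconnected U) {g : (Fin m → ℝ) → ℝ} (hg : AnalyticOnNhd ℝ g U)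
    {c : Fin m → ℝ} (hc : c ∈ U) (h : ∀ α, pdMulti α g c = 0) : Set.EqOn g 0 U := by
  refine hg.eqOn_zero_of_preconnected_of_eventuallyEq_zero hUconn hc ?_
  obtain ⟨ε, hε, hball⟩ := Metric.isOpen_iff.mp hU c hc
  filter_upwards [Metric.ball_mem_nhds c hε] with z hz
  exact eq_zero_of_pd_foldr_eq_zero hε (hg.mono hball) (List.finRange m) (List.nodup_finRange m)
    z hz fun α => by
      simp only [List.mem_finRange, if_true]
      exact h α

end PartialDerivatives

section Pfaffian

variable {m d : ℕ} {U : Set (Fin m → ℝ)}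
  {A : Fin m → (Fin m → ℝ) → Matrix (Fin d) (Fin d) ℝ}

theorem Dop_analyticOnNhd (hA : ∀ i k l, AnalyticOnNhd ℝ (fun z => A i z k l) U) (i : Fin m)
    {M : (Fin m → ℝ) → Matrix (Fin d) (Fin d) ℝ}
    (hM : ∀ k l, AnalyticOnNhd ℝ (fun z => M z k l) U) (k l : Fin d) :
    AnalyticOnNhd ℝ (fun z => Dop A i M z k l) U := by
  simp only [Dop, Matrix.add_apply, Matrix.mul_apply, Matrix.transpose_apply]
  refine (AnalyticOnNhd.add ?_ ?_).add (pd_analyticOnNhd i (hM k l))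
  · exact Finset.analyticOnNhd_fun_sum _ fun j _ => (hA i j k).mul (hM j l)
  · exact Finset.analyticOnNhd_fun_sum _ fun j _ => (hM k j).mul (hA i j l)

theorem analyticOnNhd_dotProduct_mulVec {u v : (Fin m → ℝ) → Fin d → ℝ}
    (hu : AnalyticOnNhd ℝ u U) (hv : AnalyticOnNhd ℝ v U)
    {M : (Fin m → ℝ) → Matrix (Fin d) (Fin d) ℝ}
    (hM : ∀ k l, AnalyticOnNhd ℝ (fun z => M z k l) U) :
    AnalyticOnNhd ℝ (fun z => u z ⬝ᵥ (M z *ᵥ v z)) U := by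
  simp only [dotProduct, mulVec]
  have hu' : ∀ k, AnalyticOnNhd ℝ (fun z => u z k) U := fun k z hz =>
    analyticAt_pi_iff.mp (hu z hz) k
  have hv' : ∀ k, AnalyticOnNhd ℝ (fun z => v z k) U := fun k z hz =>
    analyticAt_pi_iff.mp (hv z hz) k
  exact Finset.analyticOnNhd_fun_sum _ fun k _ => (hu' k).mul
    (Finset.analyticOnNhd_fun_sum _ fun l _ => (hM k l).mul (hv' l))

/-- Differentiating `uᵀ M v` along solutions of the Pfaffian system gives `uᵀ (D_i M) v`. -/
theorem pd_dotProduct_mulVec {u v : (Fin m → ℝ) → Fin d → ℝ} {z : Fin m → ℝ} (i : Fin m)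
    (hu : DifferentiableAt ℝ u z) (hv : DifferentiableAt ℝ v z)
    (hud : fderiv ℝ u z (Pi.single i 1) = A i z *ᵥ u z)
    (hvd : fderiv ℝ v z (Pi.single i 1) = A i z *ᵥ v z)
    {M : (Fin m → ℝ) → Matrix (Fin d) (Fin d) ℝ}
    (hM : ∀ k l, DifferentiableAt ℝ (fun z => M z k l) z) :
    pd i (fun z => u z ⬝ᵥ (M z *ᵥ v z)) z = u z ⬝ᵥ (Dop A i M z *ᵥ v z) := by
  have hu' := hasFDerivAt_pi'.mp hu.hasFDerivAt
  have hv' := hasFDerivAt_pi'.mp hv.hasFDerivAt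
  have hsum : HasFDerivAt (fun z => ∑ k, u z k * ∑ l, M z k l * v z l) _ z :=
    HasFDerivAt.fun_sum fun k _ => (hu' k).mul
      (HasFDerivAt.fun_sum fun l _ => (hM k l).hasFDerivAt.mul (hv' l))
  have hpd : pd i (fun z => u z ⬝ᵥ (M z *ᵥ v z)) z =
      u z ⬝ᵥ (M z *ᵥ (A i z *ᵥ v z)) + u z ⬝ᵥ (pdM i M z *ᵥ v z) +
        (A i z *ᵥ u z) ⬝ᵥ (M z *ᵥ v z) := by
    rw [← hud, ← hvd]
    simp only [pd, dotProduct, mulVec, pdM, Matrix.of_apply]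
    rw [hsum.fderiv]
    simp only [_root_.sum_apply, _root_.add_apply, _root_.smul_apply,
      ContinuousLinearMap.comp_apply, ContinuousLinearMap.proj_apply, smul_eq_mul]
    rw [← Finset.sum_add_distrib, ← Finset.sum_add_distrib]
    refine Finset.sum_congr rfl fun k _ => ?_
    rw [Finset.sum_add_distrib]
    simp only [mul_comm]
    ring
  rw [hpd]
  have htr : (A i z *ᵥ u z) ⬝ᵥ (M z *ᵥ v z) = u z ⬝ᵥ (((A i z)ᵀ * M z) *ᵥ v z) := by
    rw [← Matrix.mulVec_mulVec, Matrix.dotProduct_mulVec (u z), Matrix.vecMul_transpose]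
  rw [htr]
  simp only [Dop, Matrix.add_mulVec, dotProduct_add, Matrix.mulVec_mulVec]
  ring

theorem pd_foldr_dotProduct_mulVec (hU : IsOpen U)
    (hA : ∀ i k l, AnalyticOnNhd ℝ (fun z => A i z k l) U) {u v : (Fin m → ℝ) → Fin d → ℝ}
    (hu : AnalyticOnNhd ℝ u U) (hv : AnalyticOnNhd ℝ v U)
    (hud : ∀ z ∈ U, ∀ i, fderiv ℝ u z (Pi.single i 1) = A i z *ᵥ u z)
    (hvd : ∀ z ∈ U, ∀ i, fderiv ℝ v z (Pi.single i 1) = A i z *ᵥ v z)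
    {M : (Fin m → ℝ) → Matrix (Fin d) (Fin d) ℝ}
    (hM : ∀ k l, AnalyticOnNhd ℝ (fun z => M z k l) U) (α : Fin m → ℕ) (L : List (Fin m)) :
    (∀ k l, AnalyticOnNhd ℝ (fun z => L.foldr (fun i F => (Dop A i)^[α i] ∘ F) id M z k l) U) ∧
    Set.EqOn (L.foldr (fun i F => (pd i)^[α i] ∘ F) id fun z => u z ⬝ᵥ (M z *ᵥ v z))
      (fun z => u z ⬝ᵥ (L.foldr (fun i F => (Dop A i)^[α i] ∘ F) id M z *ᵥ v z)) U := by
  induction L with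
  | nil => exact ⟨hM, fun z _ => rfl⟩
  | cons i L ih =>
    simp only [List.foldr_cons, Function.comp_apply]
    induction α i with
    | zero => exact ih
    | succ j ihj =>
      simp only [Function.iterate_succ_apply']
      refine ⟨Dop_analyticOnNhd hA i ihj.1, (pd_congr hU i ihj.2).trans fun z hz => ?_⟩
      exact pd_dotProduct_mulVec i (hu z hz).differentiableAt (hv z hz).differentiableAt
        (hud z hz i) (hvd z hz i) fun k l => (ihj.1 k l z hz).differentiableAt

end Pfaffian

/-- Theorem 1 of the paper: if the vectors `q_k(zbar)` satisfy the infinite family of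
algebraic equations `q_k(zbar)ᵀ (𝒟^α Ω)(zbar) q_l(zbar) = 0`, then the functions
`f_k` (whose gradients factor as `∇_x f_k = B_x q_k`, `∇_p f_k = B_p q_k`, where
`B_x`, `B_p` collect the first rows of `A_1, …, A_n` and `A_{n+1}, …, A_{2n}`)
pairwise Poisson-commute on `U`; moreover the matrix `[∇_p f₁(zbar) ⋯ ∇_p f_n(zbar)]`
equals `B_p(zbar) [q₁(zbar) ⋯ q_n(zbar)]`, so one is nonsingular iff the other is.
Here a point of `ℝⁿ × ℝⁿ` is modeled as `Fin (n + n) → ℝ`: the first `n`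
coordinates (`Fin.castAdd`) are the `x`-variables and the last `n` (`Fin.natAdd`)
are the `p`-variables, and the Poisson bracket is
`{f, g} = Σᵢ ∂_{pᵢ} f ∂_{xᵢ} g − Σᵢ ∂_{xᵢ} f ∂_{pᵢ} g`. -/
theorem stmt12 {n d : ℕ} [NeZero d]
    (U : Set (Fin (n + n) → ℝ)) (hU : IsOpen U) (hUconn : IsConnected U)
    (A : Fin (n + n) → (Fin (n + n) → ℝ) → Matrix (Fin d) (Fin d) ℝ)
    (hA : ∀ i k l, AnalyticOnNhd ℝ (fun z => A i z k l) U)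
    (Bx Bp : (Fin (n + n) → ℝ) → Matrix (Fin n) (Fin d) ℝ)
    (hBx : ∀ z k l, Bx z k l = A (Fin.castAdd n k) z 0 l)
    (hBp : ∀ z k l, Bp z k l = A (Fin.natAdd n k) z 0 l)
    (Ω : (Fin (n + n) → ℝ) → Matrix (Fin d) (Fin d) ℝ)
    (hΩ : ∀ z, Ω z = (Bp z)ᵀ * Bx z - (Bx z)ᵀ * Bp z)
    (q : Fin n → (Fin (n + n) → ℝ) → (Fin d → ℝ))
    (hqa : ∀ k, AnalyticOnNhd ℝ (q k) U)
    (hq : ∀ k, ∀ z ∈ U, ∀ i, fderiv ℝ (q k) z (Pi.single i 1) = A i z *ᵥ q k z)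
    (f : Fin n → (Fin (n + n) → ℝ) → ℝ)
    (hf : ∀ k, DifferentiableOn ℝ (f k) U)
    (hgx : ∀ k, ∀ z ∈ U, ∀ i : Fin n,
      fderiv ℝ (f k) z (Pi.single (Fin.castAdd n i) 1) = (Bx z *ᵥ q k z) i)
    (hgp : ∀ k, ∀ z ∈ U, ∀ i : Fin n,
      fderiv ℝ (f k) z (Pi.single (Fin.natAdd n i) 1) = (Bp z *ᵥ q k z) i)
    (zbar : Fin (n + n) → ℝ) (hzbar : zbar ∈ U)
    (hcond : ∀ α : Fin (n + n) → ℕ, ∀ k l : Fin n, k < l →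
      q k zbar ⬝ᵥ (DopMulti A α Ω zbar *ᵥ q l zbar) = 0) :
    (∀ z ∈ U, ∀ k l : Fin n, k < l →
      (∑ i : Fin n, fderiv ℝ (f k) z (Pi.single (Fin.natAdd n i) 1) *
          fderiv ℝ (f l) z (Pi.single (Fin.castAdd n i) 1)) -
        (∑ i : Fin n, fderiv ℝ (f k) z (Pi.single (Fin.castAdd n i) 1) *
          fderiv ℝ (f l) z (Pi.single (Fin.natAdd n i) 1)) = 0) ∧
    (Matrix.of (fun (i : Fin n) (k : Fin n) =>
        fderiv ℝ (f k) zbar (Pi.single (Fin.natAdd n i) 1))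
      = Bp zbar * Matrix.of (fun (i : Fin d) (k : Fin n) => q k zbar i)) ∧
    ((Matrix.of (fun (i : Fin n) (k : Fin n) =>
        fderiv ℝ (f k) zbar (Pi.single (Fin.natAdd n i) 1))).det ≠ 0 ↔
      (Bp zbar * Matrix.of (fun (i : Fin d) (k : Fin n) => q k zbar i)).det ≠ 0) := by
  have hΩa : ∀ k l, AnalyticOnNhd ℝ (fun z => Ω z k l) U := by
    intro k l
    simp only [hΩ, Matrix.sub_apply, Matrix.mul_apply, Matrix.transpose_apply, hBx, hBp]
    exact (Finset.analyticOnNhd_fun_sum _ fun j _ => (hA _ _ _).mul (hA _ _ _)).sub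
      (Finset.analyticOnNhd_fun_sum _ fun j _ => (hA _ _ _).mul (hA _ _ _))
  have hmat : Matrix.of (fun (i : Fin n) (k : Fin n) =>
        fderiv ℝ (f k) zbar (Pi.single (Fin.natAdd n i) 1))
      = Bp zbar * Matrix.of (fun (i : Fin d) (k : Fin n) => q k zbar i) := by
    ext i k
    exact hgp k zbar hzbar i
  refine ⟨fun z hz k l hkl => ?_, hmat, by rw [hmat]⟩
  have hzero := eqOn_zero_of_pdMulti_eq_zero hU hUconn.isPreconnected
    (analyticOnNhd_dotProduct_mulVec (hqa k) (hqa l) hΩa) hzbar fun α =>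
      ((pd_foldr_dotProduct_mulVec hU hA (hqa k) (hqa l) (hq k) (hq l) hΩa α
        (List.finRange (n + n))).2 hzbar).trans (hcond α k l hkl)
  have hbracket : (Bp z *ᵥ q k z) ⬝ᵥ (Bx z *ᵥ q l z) - (Bx z *ᵥ q k z) ⬝ᵥ (Bp z *ᵥ q l z) = 0 := by
    have hz0 : q k z ⬝ᵥ (Ω z *ᵥ q l z) = 0 := hzero hz
    rwa [hΩ, Matrix.sub_mulVec, dotProduct_sub, ← Matrix.mulVec_mulVec, ← Matrix.mulVec_mulVec,
      Matrix.dotProduct_mulVec _ (Bp z)ᵀ, Matrix.dotProduct_mulVec _ (Bx z)ᵀ,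
      Matrix.vecMul_transpose, Matrix.vecMul_transpose] at hz0
  simpa only [hgx _ z hz, hgp _ z hz, dotProduct] using hbracket
end

section
/- Let U ⊆ ℝ^m be open, let A₁, …, A_m : U → ℝ^{d×d} and Ω : U → ℝ^{d×d} be smooth matrix-valued functions, and let Γ = {γ₀, γ₁, …, γ_{t−1}} ⊂ ℤ_{≥0}^m be a finite set of multi-indices with γ₀ = 0. Suppose there exist functions c_{ikl} : U → ℝ (i = 1, …, m; k, l = 0, …, t−1) such that D_i(𝒟^{γ_k} Ω) = Σ_{l=0}^{t−1} c_{ikl} · 𝒟^{γ_l} Ω on U for all i and k. Then for every pair of smooth solutions q_f, q_g : U → ℝ^d of the Pfaffian system ∂_i q = A_i q, the vector-valued function r : U → ℝ^t with components r_k = ∂^{γ_k}(q_fᵀ Ω q_g) (k = 0, …, t−1) satisfies the Pfaffian system ∂_i r = T_i r (i = 1, …, m), where T_i : U → ℝ^{t×t} is the matrix whose (k, l)-entry is c_{ikl}. -/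
open Matrix

/-- Entrywise smoothness of `M` on `U`, together with `f = q_fᵀ M q_g` on `U`. -/
def IsBilinearRep {m d : ℕ} (U : Set (Fin m → ℝ)) (qf qg : (Fin m → ℝ) → (Fin d → ℝ))
    (f : (Fin m → ℝ) → ℝ) (M : (Fin m → ℝ) → Matrix (Fin d) (Fin d) ℝ) : Prop :=
  (∀ k l, ContDiffOn ℝ (⊤ : ℕ∞) (fun z => M z k l) U) ∧
    ∀ z ∈ U, f z = qf z ⬝ᵥ (M z *ᵥ qg z)

theorem contDiffOn_Dop {m d : ℕ} {U : Set (Fin m → ℝ)} (hU : IsOpen U)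
    {A : Fin m → (Fin m → ℝ) → Matrix (Fin d) (Fin d) ℝ}
    (hA : ∀ i k l, ContDiffOn ℝ (⊤ : ℕ∞) (fun z => A i z k l) U)
    {M : (Fin m → ℝ) → Matrix (Fin d) (Fin d) ℝ}
    (hM : ∀ k l, ContDiffOn ℝ (⊤ : ℕ∞) (fun z => M z k l) U) (i : Fin m) (k l : Fin d) :
    ContDiffOn ℝ (⊤ : ℕ∞) (fun z => Dop A i M z k l) U := by
  simp only [Dop, pdM, Matrix.add_apply, Matrix.mul_apply, Matrix.transpose_apply,
    Matrix.of_apply]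
  refine ((ContDiffOn.sum fun j _ => (hA i j k).mul (hM j l)).add
    (ContDiffOn.sum fun j _ => (hM k j).mul (hA i j l))).add ?_
  exact ((hM k l).fderiv_of_isOpen hU (by exact_mod_cast le_refl _)).clm_apply contDiffOn_const

theorem differentiableAt_and_fderiv_dotProduct_mulVec {m d : ℕ} {qf qg : (Fin m → ℝ) → (Fin d → ℝ)}
    {M : (Fin m → ℝ) → Matrix (Fin d) (Fin d) ℝ} {z : Fin m → ℝ}
    (hf : DifferentiableAt ℝ qf z) (hg : DifferentiableAt ℝ qg z)
    (hM : ∀ k l, DifferentiableAt ℝ (fun w => M w k l) z) (v : Fin m → ℝ) :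
    DifferentiableAt ℝ (fun w => qf w ⬝ᵥ (M w *ᵥ qg w)) z ∧
    fderiv ℝ (fun w => qf w ⬝ᵥ (M w *ᵥ qg w)) z v =
      fderiv ℝ qf z v ⬝ᵥ (M z *ᵥ qg z) + qf z ⬝ᵥ (M z *ᵥ fderiv ℝ qg z v) +
      qf z ⬝ᵥ (Matrix.of (fun k l => fderiv ℝ (fun w => M w k l) z v) *ᵥ qg z) := by
  have hf' := fun k => hasFDerivAt_pi'.1 hf.hasFDerivAt k
  have hg' := fun k => hasFDerivAt_pi'.1 hg.hasFDerivAt k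
  have key : HasFDerivAt (fun w => qf w ⬝ᵥ (M w *ᵥ qg w)) _ z :=
    HasFDerivAt.fun_sum (u := Finset.univ) fun k _ => (hf' k).mul
      (HasFDerivAt.fun_sum (u := Finset.univ) fun l _ => ((hM k l).hasFDerivAt).mul (hg' l))
  refine ⟨key.differentiableAt, ?_⟩
  rw [key.fderiv]
  simp [dotProduct, Matrix.mulVec, Finset.mul_sum, Finset.sum_add_distrib]
  simp only [← Finset.sum_add_distrib]
  refine Finset.sum_congr rfl fun k _ => ?_
  simp only [Finset.sum_mul, ← Finset.sum_add_distrib]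
  refine Finset.sum_congr rfl fun l _ => ?_
  ring

section

variable {m d : ℕ} {U : Set (Fin m → ℝ)}
  {A : Fin m → (Fin m → ℝ) → Matrix (Fin d) (Fin d) ℝ}
  {qf qg : (Fin m → ℝ) → (Fin d → ℝ)}
  {f : (Fin m → ℝ) → ℝ} {M : (Fin m → ℝ) → Matrix (Fin d) (Fin d) ℝ}

theorem IsBilinearRep.eventuallyEq (h : IsBilinearRep U qf qg f M) (hU : IsOpen U)
    {z : Fin m → ℝ} (hz : z ∈ U) : f =ᶠ[nhds z] fun w => qf w ⬝ᵥ (M w *ᵥ qg w) := by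
  filter_upwards [hU.mem_nhds hz] with w hw using h.2 w hw

theorem IsBilinearRep.differentiableAt (h : IsBilinearRep U qf qg f M) (hU : IsOpen U)
    (hqf : ContDiffOn ℝ (⊤ : ℕ∞) qf U) (hqg : ContDiffOn ℝ (⊤ : ℕ∞) qg U)
    {z : Fin m → ℝ} (hz : z ∈ U) : DifferentiableAt ℝ f z := by
  have hz' := hU.mem_nhds hz
  exact (h.eventuallyEq hU hz).differentiableAt_iff.2
    (differentiableAt_and_fderiv_dotProduct_mulVec ((hqf.contDiffAt hz').differentiableAt (by simp))
      ((hqg.contDiffAt hz').differentiableAt (by simp))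
      (fun k l => ((h.1 k l).contDiffAt hz').differentiableAt (by simp)) 0).1

theorem IsBilinearRep.pd_Dop (h : IsBilinearRep U qf qg f M) (hU : IsOpen U)
    (hA : ∀ i k l, ContDiffOn ℝ (⊤ : ℕ∞) (fun z => A i z k l) U)
    (hqf : ContDiffOn ℝ (⊤ : ℕ∞) qf U) (hqg : ContDiffOn ℝ (⊤ : ℕ∞) qg U)
    (hqf' : ∀ z ∈ U, ∀ i, fderiv ℝ qf z (Pi.single i 1) = A i z *ᵥ qf z)
    (hqg' : ∀ z ∈ U, ∀ i, fderiv ℝ qg z (Pi.single i 1) = A i z *ᵥ qg z) (i : Fin m) :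
    IsBilinearRep U qf qg (pd i f) (Dop A i M) := by
  refine ⟨contDiffOn_Dop hU hA h.1 i, fun z hz => ?_⟩
  have hz' := hU.mem_nhds hz
  have key := (differentiableAt_and_fderiv_dotProduct_mulVec ((hqf.contDiffAt hz').differentiableAt (by simp))
      ((hqg.contDiffAt hz').differentiableAt (by simp))
      (fun k l => ((h.1 k l).contDiffAt hz').differentiableAt (by simp)) (Pi.single i 1)).2
  rw [pd, (h.eventuallyEq hU hz).fderiv_eq, key, hqf' z hz, hqg' z hz]
  simp only [Dop, pdM, Matrix.add_mulVec, dotProduct_add, Matrix.mulVec_mulVec]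
  rw [← Matrix.mulVec_mulVec (qg z) (A i z)ᵀ (M z), Matrix.dotProduct_mulVec _ (A i z)ᵀ,
    Matrix.vecMul_transpose]

theorem IsBilinearRep.pdMulti_DopMulti (h : IsBilinearRep U qf qg f M) (hU : IsOpen U)
    (hA : ∀ i k l, ContDiffOn ℝ (⊤ : ℕ∞) (fun z => A i z k l) U)
    (hqf : ContDiffOn ℝ (⊤ : ℕ∞) qf U) (hqg : ContDiffOn ℝ (⊤ : ℕ∞) qg U)
    (hqf' : ∀ z ∈ U, ∀ i, fderiv ℝ qf z (Pi.single i 1) = A i z *ᵥ qf z)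
    (hqg' : ∀ z ∈ U, ∀ i, fderiv ℝ qg z (Pi.single i 1) = A i z *ᵥ qg z)
    (α : Fin m → ℕ) : IsBilinearRep U qf qg (pdMulti α f) (DopMulti A α M) := by
  unfold pdMulti DopMulti
  induction List.finRange m with
  | nil => exact h
  | cons i L ih =>
    simp only [List.foldr_cons, Function.comp_apply]
    induction α i with
    | zero => exact ih
    | succ n ihn =>
      rw [Function.iterate_succ_apply', Function.iterate_succ_apply']
      exact ihn.pd_Dop hU hA hqf hqg hqf' hqg' i

end

/-- If `D_i (𝒟^{γ_k} Ω) = Σ_l c_{ikl} 𝒟^{γ_l} Ω` on `U`, then for every pair of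
smooth solutions `q_f, q_g` of the Pfaffian system `∂_i q = A_i q`, the vector
`r = (∂^{γ_k}(q_fᵀ Ω q_g))_{k}` satisfies the Pfaffian system `∂_i r = T_i r`,
where `(T_i)_{kl} = c_{ikl}`. -/
theorem stmt13 {m d t : ℕ} [NeZero t]
    (U : Set (Fin m → ℝ)) (hU : IsOpen U)
    (A : Fin m → (Fin m → ℝ) → Matrix (Fin d) (Fin d) ℝ)
    (Ω : (Fin m → ℝ) → Matrix (Fin d) (Fin d) ℝ)
    (hA : ∀ i k l, ContDiffOn ℝ (⊤ : ℕ∞) (fun z => A i z k l) U)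
    (hΩ : ∀ k l, ContDiffOn ℝ (⊤ : ℕ∞) (fun z => Ω z k l) U)
    (γ : Fin t → (Fin m → ℕ)) (hγ0 : γ 0 = 0)
    (c : Fin m → Fin t → Fin t → (Fin m → ℝ) → ℝ)
    (hc : ∀ i k, ∀ z ∈ U,
      Dop A i (DopMulti A (γ k) Ω) z = ∑ l, c i k l z • DopMulti A (γ l) Ω z)
    (qf qg : (Fin m → ℝ) → (Fin d → ℝ))
    (hqf : ContDiffOn ℝ (⊤ : ℕ∞) qf U) (hqg : ContDiffOn ℝ (⊤ : ℕ∞) qg U)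
    (hqf' : ∀ z ∈ U, ∀ i, fderiv ℝ qf z (Pi.single i 1) = A i z *ᵥ qf z)
    (hqg' : ∀ z ∈ U, ∀ i, fderiv ℝ qg z (Pi.single i 1) = A i z *ᵥ qg z) :
    ∀ z ∈ U, ∀ i,
      fderiv ℝ (fun y => (fun k : Fin t =>
          pdMulti (γ k) (fun w => qf w ⬝ᵥ (Ω w *ᵥ qg w)) y)) z (Pi.single i 1)
        = Matrix.of (fun k l : Fin t => c i k l z) *ᵥ
            (fun k : Fin t => pdMulti (γ k) (fun w => qf w ⬝ᵥ (Ω w *ᵥ qg w)) z) := by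
  intro z hz i
  have rep := fun k => IsBilinearRep.pdMulti_DopMulti
    (f := fun w => qf w ⬝ᵥ (Ω w *ᵥ qg w)) ⟨hΩ, fun _ _ => rfl⟩ hU hA hqf hqg hqf' hqg' (γ k)
  rw [fderiv_pi fun k => (rep k).differentiableAt hU hqf hqg hz]
  ext k
  have step := ((rep k).pd_Dop hU hA hqf hqg hqf' hqg' i).2 z hz
  rw [hc i k z hz, Matrix.sum_mulVec, dotProduct_sum] at step
  refine step.trans (Finset.sum_congr rfl fun l _ => ?_)
  rw [Matrix.smul_mulVec, dotProduct_smul, ← (rep l).2 z hz]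
  rfl
end

section
/- Let U ⊆ ℝ^m be open, let A₁, …, A_m : U → ℝ^{d×d} be smooth matrix-valued functions satisfying the integrability condition ∂_j A_i + A_i A_j = ∂_i A_j + A_j A_i on U for all 1 ≤ i < j ≤ m, and let Ω : U → ℝ^{d×d} be smooth. Let Γ = {γ₀, …, γ_{t−1}} ⊂ ℤ_{≥0}^m and let c_{ikl} : U → ℝ be differentiable functions such that D_i(𝒟^{γ_k} Ω) = Σ_{l=0}^{t−1} c_{ikl} · 𝒟^{γ_l} Ω on U for all i ∈ {1, …, m} and k ∈ {0, …, t−1}. Assume moreover that the family {𝒟^{γ_0} Ω, …, 𝒟^{γ_{t−1}} Ω} is linearly independent over the ring of real-valued functions on U, i.e., whenever functions a₀, …, a_{t−1} : U → ℝ satisfy Σ_{l=0}^{t−1} a_l · 𝒟^{γ_l} Ω = 0 on U, then a₀ = ⋯ = a_{t−1} = 0 on U. Then the matrices T_i : U → ℝ^{t×t} with (k, l)-entry c_{ikl} satisfy the integrability condition ∂_j T_i + T_i T_j = ∂_i T_j + T_j T_i on U for all 1 ≤ i < j ≤ m. -/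
open Matrix

/-- Entrywise differentiability at a point of a matrix-valued function. -/
def EntriesDiffAt {m d : ℕ} (M : (Fin m → ℝ) → Matrix (Fin d) (Fin d) ℝ) (z : Fin m → ℝ) :
    Prop :=
  ∀ k l, DifferentiableAt ℝ (fun y => M y k l) z

/-- Entrywise smoothness on a set of a matrix-valued function. -/
def EntriesSmoothOn {m d : ℕ} (M : (Fin m → ℝ) → Matrix (Fin d) (Fin d) ℝ)
    (U : Set (Fin m → ℝ)) : Prop :=
  ∀ k l, ContDiffOn ℝ (⊤ : ℕ∞) (fun y => M y k l) U

section

variable {m d : ℕ} {M N : (Fin m → ℝ) → Matrix (Fin d) (Fin d) ℝ}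
  {z : Fin m → ℝ} {U : Set (Fin m → ℝ)}

theorem EntriesSmoothOn.diffAt (hM : EntriesSmoothOn M U) (hU : IsOpen U) (hz : z ∈ U) :
    EntriesDiffAt M z := fun k l =>
  ((hM k l).differentiableOn (by simp)).differentiableAt (hU.mem_nhds hz)

theorem EntriesSmoothOn.add (hM : EntriesSmoothOn M U) (hN : EntriesSmoothOn N U) :
    EntriesSmoothOn (fun y => M y + N y) U := fun k l => (hM k l).add (hN k l)

theorem EntriesSmoothOn.mul (hM : EntriesSmoothOn M U) (hN : EntriesSmoothOn N U) :
    EntriesSmoothOn (fun y => M y * N y) U := fun k l => by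
  simp only [Matrix.mul_apply]
  exact ContDiffOn.sum fun x _ => (hM k x).mul (hN x l)

theorem EntriesSmoothOn.transpose (hM : EntriesSmoothOn M U) :
    EntriesSmoothOn (fun y => (M y)ᵀ) U := fun k l => hM l k

theorem EntriesSmoothOn.partialDeriv (hM : EntriesSmoothOn M U) (hU : IsOpen U) (i : Fin m) :
    EntriesSmoothOn (pdM i M) U := fun k l =>
  ((hM k l).fderiv_of_isOpen hU (m := (⊤ : ℕ∞)) (by simp)).clm_apply contDiffOn_const

theorem EntriesSmoothOn.dop {A : Fin m → (Fin m → ℝ) → Matrix (Fin d) (Fin d) ℝ}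
    (hA : ∀ i, EntriesSmoothOn (A i) U) (hM : EntriesSmoothOn M U) (hU : IsOpen U)
    (i : Fin m) : EntriesSmoothOn (Dop A i M) U :=
  (((hA i).transpose.mul hM).add (hM.mul (hA i))).add (hM.partialDeriv hU i)

theorem EntriesSmoothOn.dopMulti {A : Fin m → (Fin m → ℝ) → Matrix (Fin d) (Fin d) ℝ}
    (hA : ∀ i, EntriesSmoothOn (A i) U) (hM : EntriesSmoothOn M U) (hU : IsOpen U)
    (α : Fin m → ℕ) : EntriesSmoothOn (DopMulti A α M) U := by
  unfold DopMulti
  induction List.finRange m with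
  | nil => exact hM
  | cons i L ih =>
    simp only [List.foldr_cons, Function.comp_apply]
    induction α i with
    | zero => exact ih
    | succ n ihn =>
      rw [Function.iterate_succ_apply']
      exact ihn.dop hA hU i

theorem EntriesDiffAt.mul (hM : EntriesDiffAt M z) (hN : EntriesDiffAt N z) :
    EntriesDiffAt (fun y => M y * N y) z := fun k l => by
  simp only [Matrix.mul_apply]
  exact DifferentiableAt.fun_sum fun x _ => (hM k x).mul (hN x l)

theorem pdM_congr (h : M =ᶠ[nhds z] N) (i : Fin m) : pdM i M z = pdM i N z := by
  ext k l
  have : (fun y => M y k l) =ᶠ[nhds z] fun y => N y k l := h.mono fun y hy => by simp [hy]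
  simp [pdM, this.fderiv_eq]

theorem pdM_add (hM : EntriesDiffAt M z) (hN : EntriesDiffAt N z) (i : Fin m) :
    pdM i (fun y => M y + N y) z = pdM i M z + pdM i N z := by
  ext k l
  simp [pdM, fderiv_fun_add (hM k l) (hN k l)]

theorem pdM_mul (hM : EntriesDiffAt M z) (hN : EntriesDiffAt N z) (i : Fin m) :
    pdM i (fun y => M y * N y) z = pdM i M z * N z + M z * pdM i N z := by
  ext k l
  simp only [pdM, Matrix.mul_apply, Matrix.of_apply, Matrix.add_apply]
  rw [fderiv_fun_sum fun x _ => (hM k x).fun_mul (hN x l), _root_.sum_apply,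
    ← Finset.sum_add_distrib]
  refine Finset.sum_congr rfl fun x _ => ?_
  rw [fderiv_fun_mul (hM k x) (hN x l)]
  simp
  ring

theorem pdM_transpose (i : Fin m) : pdM i (fun y => (M y)ᵀ) z = (pdM i M z)ᵀ := rfl

theorem pdM_sum_smul {ι : Type*} [Fintype ι] {f : ι → (Fin m → ℝ) → ℝ}
    {F : ι → (Fin m → ℝ) → Matrix (Fin d) (Fin d) ℝ}
    (hf : ∀ x, DifferentiableAt ℝ (f x) z) (hF : ∀ x, EntriesDiffAt (F x) z) (i : Fin m) :
    pdM i (fun y => ∑ x, f x y • F x y) z =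
      ∑ x, (fderiv ℝ (f x) z (Pi.single i 1) • F x z + f x z • pdM i (F x) z) := by
  ext k l
  simp only [pdM, Matrix.sum_apply, Matrix.smul_apply, Matrix.of_apply, Matrix.add_apply,
    smul_eq_mul]
  rw [fderiv_fun_sum fun x _ => (hf x).fun_mul (hF x k l), _root_.sum_apply]
  refine Finset.sum_congr rfl fun x _ => ?_
  rw [fderiv_fun_mul (hf x) (hF x k l)]
  simp
  ring

theorem pdM_comm (hM : EntriesSmoothOn M U) (hU : IsOpen U) (hz : z ∈ U) (i j : Fin m) :
    pdM j (pdM i M) z = pdM i (pdM j M) z := by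
  ext k l
  have hMkl : ContDiffAt ℝ (⊤ : ℕ∞) (fun y => M y k l) z := (hM k l).contDiffAt (hU.mem_nhds hz)
  have hs : IsSymmSndFDerivAt ℝ (fun y => M y k l) z :=
    hMkl.isSymmSndFDerivAt (by simpa using WithTop.coe_le_coe.2 (le_top (a := (2 : ℕ∞))))
  have hd : DifferentiableAt ℝ (fderiv ℝ fun y => M y k l) z :=
    (hMkl.fderiv_right (m := 1) (by norm_cast)).differentiableAt (by simp)
  simp only [pdM, Matrix.of_apply]
  rw [fderiv_clm_apply hd (by fun_prop), fderiv_clm_apply hd (by fun_prop)]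
  simpa using hs.eq _ _

theorem Dop_comm {A : Fin m → (Fin m → ℝ) → Matrix (Fin d) (Fin d) ℝ} (hU : IsOpen U)
    (hA : ∀ i, EntriesSmoothOn (A i) U) (hM : EntriesSmoothOn M U) (hz : z ∈ U) {i j : Fin m}
    (hint : pdM j (A i) z + A i z * A j z = pdM i (A j) z + A j z * A i z) :
    Dop A j (Dop A i M) z = Dop A i (Dop A j M) z := by
  have expand (i j : Fin m) : Dop A j (Dop A i M) z =
      (pdM j (A i) z + A i z * A j z)ᵀ * M z + M z * (pdM j (A i) z + A i z * A j z)
      + ((A j z)ᵀ * M z * A i z + (A i z)ᵀ * M z * A j z)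
      + ((A j z)ᵀ * pdM i M z + (A i z)ᵀ * pdM j M z)
      + (pdM i M z * A j z + pdM j M z * A i z) + pdM j (pdM i M) z := by
    have hAM := (hA i).transpose.mul hM
    have hMA := hM.mul (hA i)
    have h : pdM j (Dop A i M) z = _ :=
      pdM_add ((hAM.add hMA).diffAt hU hz) ((hM.partialDeriv hU i).diffAt hU hz) j
    rw [pdM_add (hAM.diffAt hU hz) (hMA.diffAt hU hz),
      pdM_mul ((hA i).transpose.diffAt hU hz) (hM.diffAt hU hz),
      pdM_mul (hM.diffAt hU hz) ((hA i).diffAt hU hz), pdM_transpose] at h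
    rw [Dop, h, Dop, Matrix.transpose_add, Matrix.transpose_mul]
    noncomm_ring
  rw [expand i j, expand j i, hint, pdM_comm hM hU hz i j]
  abel

/-- The Leibniz rule for `Dop` applied to a combination with function coefficients. -/
theorem Dop_sum_smul {A : Fin m → (Fin m → ℝ) → Matrix (Fin d) (Fin d) ℝ} {ι : Type*} [Fintype ι]
    {f : ι → (Fin m → ℝ) → ℝ} {F : ι → (Fin m → ℝ) → Matrix (Fin d) (Fin d) ℝ}
    (hM : M =ᶠ[nhds z] fun y => ∑ x, f x y • F x y)
    (hf : ∀ x, DifferentiableAt ℝ (f x) z) (hF : ∀ x, EntriesDiffAt (F x) z) (i : Fin m) :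
    Dop A i M z =
      ∑ x, (fderiv ℝ (f x) z (Pi.single i 1) • F x z + f x z • Dop A i (F x) z) := by
  rw [Dop, pdM_congr hM, pdM_sum_smul hf hF, hM.eq_of_nhds, Finset.mul_sum, Finset.sum_mul,
    ← Finset.sum_add_distrib, ← Finset.sum_add_distrib]
  refine Finset.sum_congr rfl fun x _ => ?_
  simp only [Dop, Matrix.mul_smul, Matrix.smul_mul, smul_add]
  abel

end

/-- If `A₁, …, A_m` satisfy the integrability condition, and the matrices
`𝒟^{γ_0} Ω, …, 𝒟^{γ_{t-1}} Ω` are linearly independent over the functions on `U`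
with `D_i (𝒟^{γ_k} Ω) = Σ_l c_{ikl} 𝒟^{γ_l} Ω`, then the matrices `T_i` with
entries `(T_i)_{kl} = c_{ikl}` also satisfy the integrability condition. -/
theorem stmt14 {m d t : ℕ}
    (U : Set (Fin m → ℝ)) (hU : IsOpen U)
    (A : Fin m → (Fin m → ℝ) → Matrix (Fin d) (Fin d) ℝ)
    (hA : ∀ i k l, ContDiffOn ℝ (⊤ : ℕ∞) (fun z => A i z k l) U)
    (hint : ∀ i j : Fin m, i < j → ∀ z ∈ U,
      pdM j (A i) z + A i z * A j z = pdM i (A j) z + A j z * A i z)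
    (Ω : (Fin m → ℝ) → Matrix (Fin d) (Fin d) ℝ)
    (hΩ : ∀ k l, ContDiffOn ℝ (⊤ : ℕ∞) (fun z => Ω z k l) U)
    (γ : Fin t → (Fin m → ℕ))
    (c : Fin m → Fin t → Fin t → (Fin m → ℝ) → ℝ)
    (hcdiff : ∀ i k l, DifferentiableOn ℝ (c i k l) U)
    (hc : ∀ i k, ∀ z ∈ U,
      Dop A i (DopMulti A (γ k) Ω) z = ∑ l, c i k l z • DopMulti A (γ l) Ω z)
    (hindep : ∀ a : Fin t → (Fin m → ℝ) → ℝ,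
      (∀ z ∈ U, ∑ l, a l z • DopMulti A (γ l) Ω z = 0) →
      ∀ l, ∀ z ∈ U, a l z = 0) :
    ∀ i j : Fin m, i < j → ∀ z ∈ U,
      pdM j (fun y => Matrix.of fun k l : Fin t => c i k l y) z
          + Matrix.of (fun k l : Fin t => c i k l z)
            * Matrix.of (fun k l : Fin t => c j k l z)
        = pdM i (fun y => Matrix.of fun k l : Fin t => c j k l y) z
          + Matrix.of (fun k l : Fin t => c j k l z)
            * Matrix.of (fun k l : Fin t => c i k l z) := by
  intro i j hij
  have hS (k) : EntriesSmoothOn (DopMulti A (γ k) Ω) U := EntriesSmoothOn.dopMulti hA hΩ hU (γ k)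
  let T (i : Fin m) (y : Fin m → ℝ) : Matrix (Fin t) (Fin t) ℝ := Matrix.of fun k l => c i k l y
  have expand (i j : Fin m) (k : Fin t) : ∀ z ∈ U, Dop A j (Dop A i (DopMulti A (γ k) Ω)) z =
      ∑ l, (pdM j (T i) z + T i z * T j z) k l • DopMulti A (γ l) Ω z := by
    intro z hz
    rw [Dop_sum_smul (Filter.eventually_of_mem (hU.mem_nhds hz) (hc i k))
      (fun l => (hcdiff i k l).differentiableAt (hU.mem_nhds hz))
      (fun l => (hS l).diffAt hU hz) j]
    simp only [hc j _ z hz, Finset.smul_sum, Finset.sum_add_distrib, Matrix.add_apply, add_smul,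
      Matrix.mul_apply, Finset.sum_smul, smul_smul]
    congr 1
    exact Finset.sum_comm
  intro z hz
  ext k l
  refine sub_eq_zero.mp (hindep (fun l y =>
    (pdM j (T i) y + T i y * T j y) k l - (pdM i (T j) y + T j y * T i y) k l) ?_ l z hz)
  intro y hy
  simp only [sub_smul, Finset.sum_sub_distrib]
  rw [← expand i j k y hy, ← expand j i k y hy,
    Dop_comm hU hA (hS k) hy (hint i j hij y hy), sub_self]
end
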